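/- arXiv:1911.12859 — 3 statements merged into one kernel-verified Lean document; each statement's English description precedes it below -/
import Mathlib

section
/- Extremal decomposition of diagonally dominant matrices: let Z be an n×n real symmetric diagonally dominant matrix, let e_1,…,e_n be the standard basis vectors of ℝⁿ, and set Δ_i = Z_{ii} − ∑_{j≠i} |Z_{ij}| (so Δ_i ≥ 0). Then Z = ∑_{i=1}^n Δ_i e_i e_iᵀ + ∑_{(i,j): i<j, Z_{ij}>0} Z_{ij} (e_i + e_j)(e_i + e_j)ᵀ + ∑_{(i,j): i<j, Z_{ij}<0} |Z_{ij}| (e_i − e_j)(e_i − e_j)ᵀ. -/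
open Matrix BigOperators

/-- A real symmetric matrix is diagonally dominant (DD) if each diagonal entry
dominates the sum of absolute values of the off-diagonal entries in its row. -/
def IsDiagDom {n : ℕ} (A : Matrix (Fin n) (Fin n) ℝ) : Prop :=
  ∀ i, ∑ j ∈ Finset.univ.erase i, |A i j| ≤ A i i

/-- A sum over the pairs of distinct elements of a finite linear order, grouped by unordered pairs. -/
theorem Finset.sum_filter_lt_add_swap {ι M : Type*} [Fintype ι] [LinearOrder ι] [AddCommMonoid M]
    (f : ι → ι → M) :
    ∑ q : ι × ι with q.1 < q.2, (f q.1 q.2 + f q.2 q.1) =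
      ∑ i, ∑ j ∈ univ.erase i, f i j := by
  simp only [sum_add_distrib, sum_filter, Fintype.sum_prod_type]
  rw [sum_comm (f := fun x y => if x < y then f y x else 0), ← sum_add_distrib]
  refine sum_congr rfl fun i _ => ?_
  rw [← sum_add_distrib, ← filter_ne', sum_filter]
  refine sum_congr rfl fun j _ => ?_
  rcases lt_trichotomy i j with h | rfl | h
  · simp [h, h.not_gt, h.ne']
  · simp
  · simp [h, h.not_gt, h.ne]

/-- A symmetric rank-one decomposition of a scaled `2 × 2` block, split by the sign of the scalar. -/
theorem Matrix.ite_smul_vecMulVec_add_ite_smul_vecMulVec_sub {ι : Type*} (u v : ι → ℝ) (z : ℝ) :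
    (if 0 < z then z • vecMulVec (u + v) (u + v) else 0) +
        (if z < 0 then |z| • vecMulVec (u - v) (u - v) else 0) =
      (z • vecMulVec u v + |z| • vecMulVec u u) + (z • vecMulVec v u + |z| • vecMulVec v v) := by
  rcases lt_trichotomy z 0 with h | rfl | h
  · ext a b
    simp only [h, h.not_gt, if_true, if_false, abs_of_neg h, vecMulVec_apply, add_apply,
      smul_apply, zero_apply, Pi.sub_apply, smul_eq_mul]
    ring
  · simp
  · ext a b
    simp only [h, h.not_gt, if_true, if_false, abs_of_pos h, vecMulVec_apply, add_apply,
      smul_apply, zero_apply, Pi.add_apply, smul_eq_mul]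
    ring

/-- Extremal decomposition of a symmetric diagonally dominant matrix `Z`:
`Z = ∑ᵢ Δᵢ eᵢeᵢᵀ + ∑_{i<j, Z_{ij}>0} Z_{ij}(eᵢ+eⱼ)(eᵢ+eⱼ)ᵀ
   + ∑_{i<j, Z_{ij}<0} |Z_{ij}|(eᵢ−eⱼ)(eᵢ−eⱼ)ᵀ`,
where `Δᵢ = Z_{ii} − ∑_{j≠i} |Z_{ij}|`. -/
theorem dd_extremal_decomposition {n : ℕ} (Z : Matrix (Fin n) (Fin n) ℝ)
    (hsymm : Z.IsSymm) (hdd : IsDiagDom Z) :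
    Z = (∑ i : Fin n, (Z i i - ∑ j ∈ Finset.univ.erase i, |Z i j|) •
            Matrix.vecMulVec (Pi.single i (1 : ℝ)) (Pi.single i (1 : ℝ)))
      + (∑ q ∈ Finset.univ.filter (fun q : Fin n × Fin n => q.1 < q.2 ∧ 0 < Z q.1 q.2),
            Z q.1 q.2 • Matrix.vecMulVec
              (Pi.single q.1 (1 : ℝ) + Pi.single q.2 (1 : ℝ))
              (Pi.single q.1 (1 : ℝ) + Pi.single q.2 (1 : ℝ)))
      + (∑ q ∈ Finset.univ.filter (fun q : Fin n × Fin n => q.1 < q.2 ∧ Z q.1 q.2 < 0),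
            |Z q.1 q.2| • Matrix.vecMulVec
              (Pi.single q.1 (1 : ℝ) - Pi.single q.2 (1 : ℝ))
              (Pi.single q.1 (1 : ℝ) - Pi.single q.2 (1 : ℝ))) := by
  let e : Fin n → Fin n → ℝ := fun i => Pi.single i 1
  have hE (i j : Fin n) : Matrix.single i j (Z i j) = Z i j • vecMulVec (e i) (e j) := by
    rw [← Matrix.single_eq_single_vecMulVec_single, Matrix.smul_single, smul_eq_mul, mul_one]
  rw [add_assoc, ← Finset.filter_filter, ← Finset.filter_filter, Finset.sum_filter,
    Finset.sum_filter (p := fun q : Fin n × Fin n => Z q.1 q.2 < 0), ← Finset.sum_add_distrib]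
  simp only [Matrix.ite_smul_vecMulVec_add_ite_smul_vecMulVec_sub]
  have hpair := Finset.sum_filter_lt_add_swap fun i j =>
    Z i j • vecMulVec (e i) (e j) + |Z i j| • vecMulVec (e i) (e i)
  simp only [fun q : Fin n × Fin n => hsymm.apply q.1 q.2] at hpair
  rw [hpair, ← Finset.sum_add_distrib]
  conv_lhs => rw [Matrix.matrix_eq_sum_single Z]
  refine Finset.sum_congr rfl fun i _ => ?_
  simp only [hE]
  rw [← Finset.add_sum_erase _ _ (Finset.mem_univ i), Finset.sum_add_distrib, ← Finset.sum_smul,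
    sub_smul]
  abel
end

section
/- (Proposition 1, part 1) Decomposition of sparse diagonally dominant matrices: let E be a symmetric set of off-diagonal index pairs of {1,…,n} (a graph edge set, not necessarily chordal) and let C_1,…,C_p ⊆ {1,…,n} be a clique edge cover of E. Then a real symmetric matrix Z with Z_{ij} = 0 whenever i ≠ j and (i,j) ∉ E is diagonally dominant if and only if there exist real symmetric diagonally dominant matrices Z_k of size |C_k|×|C_k|, k = 1,…,p, such that Z = ∑_{k=1}^p E_{C_k}ᵀ Z_k E_{C_k}. -/
open Matrix BigOperators

/-- The 0/1 entry-selector matrix `E_C` of an index subset `C ⊆ {1,…,n}`: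
row `k` has a `1` in the column of the `k`-th smallest element of `C`. -/
def entrySelector {n : ℕ} (C : Finset (Fin n)) : Matrix (Fin C.card) (Fin n) ℝ :=
  Matrix.of fun k i => if ((C.orderIsoOfFin rfl k : Fin n) = i) then 1 else 0

lemma entrySelector_apply {n : ℕ} (C : Finset (Fin n)) (a : Fin C.card) (i : Fin n) :
    entrySelector C a i = if C.orderEmbOfFin rfl a = i then 1 else 0 :=
  rfl

lemma exists_orderEmbOfFin_eq {n : ℕ} {C : Finset (Fin n)} {i : Fin n} (hi : i ∈ C) :
    ∃ a, C.orderEmbOfFin rfl a = i := by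
  have h := C.range_orderEmbOfFin rfl
  exact h.symm.subset (Finset.mem_coe.2 hi)

lemma entrySelector_conj_apply {n : ℕ} (C : Finset (Fin n))
    (X : Matrix (Fin C.card) (Fin C.card) ℝ) (i j : Fin n) :
    ((entrySelector C)ᵀ * X * entrySelector C) i j =
      ∑ b, (∑ a, if C.orderEmbOfFin rfl a = i then X a b else 0) *
        (if C.orderEmbOfFin rfl b = j then 1 else 0) := by
  simp [Matrix.mul_apply, entrySelector_apply]

lemma entrySelector_conj_emb {n : ℕ} (C : Finset (Fin n))
    (X : Matrix (Fin C.card) (Fin C.card) ℝ) (a b : Fin C.card) :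
    ((entrySelector C)ᵀ * X * entrySelector C) (C.orderEmbOfFin rfl a) (C.orderEmbOfFin rfl b) =
      X a b := by
  simp [entrySelector_conj_apply]

lemma entrySelector_conj_eq_zero {n : ℕ} {C : Finset (Fin n)}
    (X : Matrix (Fin C.card) (Fin C.card) ℝ) {i j : Fin n} (h : ¬ (i ∈ C ∧ j ∈ C)) :
    ((entrySelector C)ᵀ * X * entrySelector C) i j = 0 := by
  rw [entrySelector_conj_apply]
  refine Finset.sum_eq_zero fun b _ => ?_
  by_cases hj : C.orderEmbOfFin rfl b = j
  · have hi : i ∉ C := fun hi => h ⟨hi, hj ▸ C.orderEmbOfFin_mem rfl b⟩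
    have hne (a : Fin C.card) : C.orderEmbOfFin rfl a ≠ i := by
      rintro rfl
      exact hi (C.orderEmbOfFin_mem rfl a)
    simp [hne]
  · simp [hj]

/-- A matrix supported on `C × C` is recovered from its restriction to `C × C`. -/
lemma entrySelector_conj_submatrix {n : ℕ} {C : Finset (Fin n)} {Y : Matrix (Fin n) (Fin n) ℝ}
    (hY : ∀ i j, ¬ (i ∈ C ∧ j ∈ C) → Y i j = 0) :
    (entrySelector C)ᵀ * Y.submatrix (C.orderEmbOfFin rfl) (C.orderEmbOfFin rfl) *
      entrySelector C = Y := by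
  ext i j
  by_cases h : i ∈ C ∧ j ∈ C
  · obtain ⟨a, rfl⟩ := exists_orderEmbOfFin_eq h.1
    obtain ⟨b, rfl⟩ := exists_orderEmbOfFin_eq h.2
    rw [entrySelector_conj_emb, Matrix.submatrix_apply]
  · rw [entrySelector_conj_eq_zero _ h, hY i j h]

/-- For a matrix supported on `C × C`, diagonal dominance can be tested on `C × C`. -/
lemma isDiagDom_submatrix_iff {n : ℕ} {C : Finset (Fin n)} {Y : Matrix (Fin n) (Fin n) ℝ}
    (hY : ∀ i j, ¬ (i ∈ C ∧ j ∈ C) → Y i j = 0) :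
    IsDiagDom (Y.submatrix (C.orderEmbOfFin rfl) (C.orderEmbOfFin rfl)) ↔ IsDiagDom Y := by
  have hrow (a : Fin C.card) :
      ∑ b ∈ Finset.univ.erase a, |Y (C.orderEmbOfFin rfl a) (C.orderEmbOfFin rfl b)| =
        ∑ j ∈ Finset.univ.erase (C.orderEmbOfFin rfl a), |Y (C.orderEmbOfFin rfl a) j| := by
    refine (Finset.sum_map (Finset.univ.erase a) (C.orderEmbOfFin rfl).toEmbedding
      fun j => |Y (C.orderEmbOfFin rfl a) j|).symm.trans ?_
    refine Finset.sum_subset (fun j hj => ?_) fun j hj hj' => ?_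
    · obtain ⟨b, hb, rfl⟩ := Finset.mem_map.1 hj
      simpa using hb
    · rw [hY _ _ fun h => ?_, abs_zero]
      obtain ⟨b, rfl⟩ := exists_orderEmbOfFin_eq h.2
      exact hj' (Finset.mem_map.2 ⟨b, by simpa using hj, rfl⟩)
  refine ⟨fun h i => ?_, fun h a => (hrow a).trans_le (h _)⟩
  by_cases hi : i ∈ C
  · obtain ⟨a, rfl⟩ := exists_orderEmbOfFin_eq hi
    exact (hrow a).symm.trans_le (h a)
  · simp [hY i _ fun h => hi h.1]

lemma isDiagDom_entrySelector_conj {n : ℕ} {C : Finset (Fin n)}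
    {X : Matrix (Fin C.card) (Fin C.card) ℝ} (hX : IsDiagDom X) :
    IsDiagDom ((entrySelector C)ᵀ * X * entrySelector C) := by
  rw [← isDiagDom_submatrix_iff fun i j => entrySelector_conj_eq_zero X]
  convert hX
  ext a b
  exact entrySelector_conj_emb C X a b

lemma IsDiagDom.sum {n : ℕ} {ι : Type*} {s : Finset ι} {A : ι → Matrix (Fin n) (Fin n) ℝ}
    (hA : ∀ k ∈ s, IsDiagDom (A k)) : IsDiagDom (∑ k ∈ s, A k) := by
  intro i
  simp only [Matrix.sum_apply]
  calc ∑ j ∈ Finset.univ.erase i, |∑ k ∈ s, A k i j|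
      ≤ ∑ j ∈ Finset.univ.erase i, ∑ k ∈ s, |A k i j| :=
        Finset.sum_le_sum fun j _ => Finset.abs_sum_le_sum_abs _ _
    _ = ∑ k ∈ s, ∑ j ∈ Finset.univ.erase i, |A k i j| := Finset.sum_comm
    _ ≤ ∑ k ∈ s, A k i i := Finset.sum_le_sum fun k hk => hA k hk i

/-- The fraction of the weight of the pair `(i, j)` that is given to the set `C k` when it is
shared equally among all the sets containing both `i` and `j`. -/
noncomputable def coverWeight {n p : ℕ} (C : Fin p → Finset (Fin n)) (k : Fin p)
    (i j : Fin n) : ℝ :=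
  if i ∈ C k ∧ j ∈ C k then
    ((Finset.univ.filter fun l => i ∈ C l ∧ j ∈ C l).card : ℝ)⁻¹ else 0

lemma coverWeight_nonneg {n p : ℕ} (C : Fin p → Finset (Fin n)) (k : Fin p) (i j : Fin n) :
    0 ≤ coverWeight C k i j := by
  unfold coverWeight
  positivity

lemma coverWeight_comm {n p : ℕ} (C : Fin p → Finset (Fin n)) (k : Fin p) (i j : Fin n) :
    coverWeight C k i j = coverWeight C k j i := by
  simp only [coverWeight, and_comm]

lemma coverWeight_eq_zero {n p : ℕ} {C : Fin p → Finset (Fin n)} {k : Fin p} {i j : Fin n}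
    (h : ¬ (i ∈ C k ∧ j ∈ C k)) : coverWeight C k i j = 0 :=
  if_neg h

lemma sum_coverWeight {n p : ℕ} {C : Fin p → Finset (Fin n)} {i j : Fin n}
    (h : ∃ k, i ∈ C k ∧ j ∈ C k) : ∑ k, coverWeight C k i j = 1 := by
  obtain ⟨k, hk⟩ := h
  have hne : ((Finset.univ.filter fun l => i ∈ C l ∧ j ∈ C l).card : ℝ) ≠ 0 :=
    Nat.cast_ne_zero.2 (Finset.card_ne_zero_of_mem (Finset.mem_filter.2 ⟨Finset.mem_univ k, hk⟩))
  simp only [coverWeight]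
  rw [← Finset.sum_filter, Finset.sum_const, nsmul_eq_mul, mul_inv_cancel₀ hne]

/-- The part of `Z` carried by `C k`: off-diagonal entries are split according to `coverWeight`,
and each diagonal entry consists of its absolute off-diagonal row sum and a share of the slack. -/
noncomputable def cliquePart {n p : ℕ} (C : Fin p → Finset (Fin n))
    (Z : Matrix (Fin n) (Fin n) ℝ) (k : Fin p) : Matrix (Fin n) (Fin n) ℝ :=
  Matrix.of fun i j =>
    if i = j then
      ∑ l ∈ Finset.univ.erase i, coverWeight C k i l * |Z i l| +
        coverWeight C k i i * (Z i i - ∑ l ∈ Finset.univ.erase i, |Z i l|)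
    else coverWeight C k i j * Z i j

lemma cliquePart_eq_zero {n p : ℕ} {C : Fin p → Finset (Fin n)} (Z : Matrix (Fin n) (Fin n) ℝ)
    {k : Fin p} {i j : Fin n} (h : ¬ (i ∈ C k ∧ j ∈ C k)) : cliquePart C Z k i j = 0 := by
  by_cases hij : i = j
  · subst hij
    have hi : i ∉ C k := fun hi => h ⟨hi, hi⟩
    simp [cliquePart, coverWeight, hi]
  · simp [cliquePart, hij, coverWeight_eq_zero h]

lemma isSymm_cliquePart {n p : ℕ} (C : Fin p → Finset (Fin n)) {Z : Matrix (Fin n) (Fin n) ℝ}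
    (hZ : Z.IsSymm) (k : Fin p) : (cliquePart C Z k).IsSymm := by
  refine Matrix.IsSymm.ext fun i j => ?_
  by_cases hij : i = j
  · rw [hij]
  · simp [cliquePart, hij, Ne.symm hij, coverWeight_comm C k i j, hZ.apply i j]

lemma isDiagDom_cliquePart {n p : ℕ} (C : Fin p → Finset (Fin n))
    {Z : Matrix (Fin n) (Fin n) ℝ} (hZ : IsDiagDom Z) (k : Fin p) :
    IsDiagDom (cliquePart C Z k) := by
  intro i
  have hoff : ∑ j ∈ Finset.univ.erase i, |cliquePart C Z k i j| =
      ∑ j ∈ Finset.univ.erase i, coverWeight C k i j * |Z i j| := by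
    refine Finset.sum_congr rfl fun j hj => ?_
    simp [cliquePart, (Finset.ne_of_mem_erase hj).symm, abs_mul,
      abs_of_nonneg (coverWeight_nonneg C k i j)]
  have hslack := mul_nonneg (coverWeight_nonneg C k i i) (sub_nonneg.2 (hZ i))
  rw [hoff]
  simpa [cliquePart] using hslack

lemma sum_cliquePart {n p : ℕ} {C : Fin p → Finset (Fin n)} {Z : Matrix (Fin n) (Fin n) ℝ}
    (hV : ∀ i, ∃ k, i ∈ C k) (hZ : ∀ i j, i ≠ j → Z i j ≠ 0 → ∃ k, i ∈ C k ∧ j ∈ C k) :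
    ∑ k, cliquePart C Z k = Z := by
  ext i j
  rw [Matrix.sum_apply]
  by_cases hij : i = j
  · subst hij
    have hdiag : ∑ k, coverWeight C k i i = 1 := sum_coverWeight (by simpa using hV i)
    have hoff : ∑ k, ∑ l ∈ Finset.univ.erase i, coverWeight C k i l * |Z i l| =
        ∑ l ∈ Finset.univ.erase i, |Z i l| := by
      rw [Finset.sum_comm]
      refine Finset.sum_congr rfl fun l hl => ?_
      rw [← Finset.sum_mul]
      by_cases h0 : Z i l = 0
      · simp [h0]
      · rw [sum_coverWeight (hZ i l (Finset.ne_of_mem_erase hl).symm h0), one_mul]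
    simp only [cliquePart, Matrix.of_apply, if_true]
    rw [Finset.sum_add_distrib, hoff, ← Finset.sum_mul, hdiag]
    ring
  · simp only [cliquePart, Matrix.of_apply, if_neg hij]
    rw [← Finset.sum_mul]
    by_cases h0 : Z i j = 0
    · simp [h0]
    · rw [sum_coverWeight (hZ i j hij h0), one_mul]

/-- (Proposition 1, part 1.) Let `E` be a (not necessarily chordal) graph edge
set on `{1,…,n}` with clique edge cover `C_1,…,C_p`. A symmetric matrix `Z`
with sparsity pattern `E` is diagonally dominant iff it is a clique-sum
`Z = ∑ₖ E_{C_k}ᵀ Z_k E_{C_k}` of symmetric diagonally dominant matrices `Z_k`. -/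
theorem sparse_dd_decomposition {n p : ℕ}
    (E : Fin n → Fin n → Prop)
    (hEsymm : ∀ i j, E i j → E j i) (hEirrefl : ∀ i, ¬ E i i)
    (C : Fin p → Finset (Fin n))
    (hclique : ∀ k, ∀ i ∈ C k, ∀ j ∈ C k, i ≠ j → E i j)
    (hcoverE : ∀ i j, E i j → ∃ k, i ∈ C k ∧ j ∈ C k)
    (hcoverV : ∀ i : Fin n, ∃ k, i ∈ C k)
    (Z : Matrix (Fin n) (Fin n) ℝ) (hZsymm : Z.IsSymm)
    (hZsparse : ∀ i j, i ≠ j → ¬ E i j → Z i j = 0) :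
    IsDiagDom Z ↔
      ∃ Zk : (k : Fin p) → Matrix (Fin (C k).card) (Fin (C k).card) ℝ,
        (∀ k, (Zk k).IsSymm ∧ IsDiagDom (Zk k)) ∧
        Z = ∑ k, (entrySelector (C k))ᵀ * Zk k * entrySelector (C k) := by
  constructor
  · intro hZ
    refine ⟨fun k => (cliquePart C Z k).submatrix ((C k).orderEmbOfFin rfl)
      ((C k).orderEmbOfFin rfl), fun k => ⟨(isSymm_cliquePart C hZsymm k).submatrix _,
      (isDiagDom_submatrix_iff fun i j => cliquePart_eq_zero Z).2
        (isDiagDom_cliquePart C hZ k)⟩, ?_⟩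
    simp_rw [entrySelector_conj_submatrix fun i j => cliquePart_eq_zero Z]
    exact (sum_cliquePart hcoverV fun i j hij h0 =>
      hcoverE i j (not_imp_comm.1 (hZsparse i j hij) h0)).symm
  · rintro ⟨Zk, hZk, rfl⟩
    exact IsDiagDom.sum fun k _ => isDiagDom_entrySelector_conj (hZk k).2
end

section
/- Dual equality for disjoint cliques: let C_1,…,C_p ⊆ {1,…,n} be pairwise disjoint index subsets whose union is {1,…,n}, and for each k let K_k be a nonempty set of real symmetric |C_k|×|C_k| matrices containing the zero matrix. Define K(E,?) = { X symmetric n×n : E_{C_k} X E_{C_k}ᵀ ∈ K_k for each k } and K*(E,0) = { ∑_{k=1}^p E_{C_k}ᵀ M_k E_{C_k} : M_k ∈ K_k* for each k }. Then [K(E,?)]* = K*(E,0), where [K(E,?)]* is the dual cone of K(E,?) in the space of real symmetric n×n matrices with the Frobenius inner product and K_k* is the dual cone of K_k in the space of symmetric |C_k|×|C_k| matrices. -/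
open Matrix BigOperators

/-- Dual cone of a set `S` of real `m × m` matrices, taken in the space of real
symmetric matrices with the Frobenius inner product `⟨A,B⟩ = trace(AᵀB)`. -/
def dualCone {m : ℕ} (S : Set (Matrix (Fin m) (Fin m) ℝ)) :
    Set (Matrix (Fin m) (Fin m) ℝ) :=
  {M | M.IsSymm ∧ ∀ N ∈ S, 0 ≤ (Mᵀ * N).trace}

theorem entrySelector_mul_transpose_self {n : ℕ} (C : Finset (Fin n)) :
    entrySelector C * (entrySelector C)ᵀ = 1 := by
  ext a b
  simp [Matrix.mul_apply, entrySelector, Matrix.one_apply, eq_comm]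

theorem entrySelector_mul_transpose_of_disjoint {n : ℕ} {C D : Finset (Fin n)}
    (h : Disjoint C D) : entrySelector C * (entrySelector D)ᵀ = 0 := by
  ext a b
  have hne : (D.orderIsoOfFin rfl b : Fin n) ≠ C.orderIsoOfFin rfl a := fun heq =>
    Finset.disjoint_left.mp h (C.orderIsoOfFin rfl a).2
      (heq ▸ (D.orderIsoOfFin rfl b).2)
  simp only [Matrix.mul_apply, entrySelector, Matrix.transpose_apply, Matrix.of_apply,
    Matrix.zero_apply]
  refine Finset.sum_eq_zero fun j _ => ?_
  rw [ite_mul, one_mul, zero_mul]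
  split_ifs with hC hD
  · exact absurd (hD.trans hC.symm) hne
  · rfl
  · rfl

theorem entrySelector_transpose_mul_self_apply {n : ℕ} (C : Finset (Fin n)) (i j : Fin n) :
    ((entrySelector C)ᵀ * entrySelector C) i j = if i = j ∧ i ∈ C then 1 else 0 := by
  have hsum := (C.orderIsoOfFin rfl).toEquiv.sum_comp
    (fun x : C => (if (x : Fin n) = i then (1 : ℝ) else 0) * if (x : Fin n) = j then 1 else 0)
  have hcoe := Finset.sum_coe_sort C
    (fun x : Fin n => (if x = i then (1 : ℝ) else 0) * if x = j then 1 else 0)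
  simp only [Matrix.mul_apply, entrySelector, Matrix.transpose_apply, Matrix.of_apply]
  refine (hsum.trans hcoe).trans ?_
  by_cases hij : i = j <;> by_cases hi : i ∈ C <;> simp [hij, hi, Finset.sum_ite_eq'] <;> grind

theorem sum_entrySelector_transpose_mul_self {n p : ℕ} (C : Fin p → Finset (Fin n))
    (hdisj : ∀ k k', k ≠ k' → Disjoint (C k) (C k')) (hcover : ∀ i : Fin n, ∃ k, i ∈ C k) :
    ∑ k, (entrySelector (C k))ᵀ * entrySelector (C k) = 1 := by
  ext i j
  obtain ⟨k, hk⟩ := hcover i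
  rw [Matrix.sum_apply, Finset.sum_eq_single k]
  · simp [entrySelector_transpose_mul_self_apply, hk, Matrix.one_apply]
  · intro l _ hl
    have hil : i ∉ C l := Finset.disjoint_left.mp (hdisj k l hl.symm) hk
    simp [entrySelector_transpose_mul_self_apply, hil]
  · simp

theorem trace_transpose_compress_mul {m l n : Type*} [Fintype m] [Fintype l] [Fintype n]
    (A : Matrix m n ℝ) (B : Matrix l n ℝ) (M : Matrix n n ℝ) (Z : Matrix m l ℝ) :
    ((A * M * Bᵀ)ᵀ * Z).trace = (Mᵀ * (Aᵀ * Z * B)).trace := by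
  rw [Matrix.transpose_mul, Matrix.transpose_mul, Matrix.transpose_transpose,
    Matrix.mul_assoc, Matrix.trace_mul_comm]
  simp only [Matrix.mul_assoc]

/-- A matrix in the dual cone of the completable matrices has zero blocks between distinct
cliques. -/
theorem offDiagonal_block_eq_zero {n p : ℕ} (C : Fin p → Finset (Fin n))
    (hdisj : ∀ k k', k ≠ k' → Disjoint (C k) (C k'))
    (K : (k : Fin p) → Set (Matrix (Fin (C k).card) (Fin (C k).card) ℝ))
    (hK0 : ∀ k, (0 : Matrix (Fin (C k).card) (Fin (C k).card) ℝ) ∈ K k)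
    {M : Matrix (Fin n) (Fin n) ℝ}
    (hM : M ∈ dualCone {X : Matrix (Fin n) (Fin n) ℝ | X.IsSymm ∧
        ∀ k, entrySelector (C k) * X * (entrySelector (C k))ᵀ ∈ K k})
    {k l : Fin p} (hkl : k ≠ l) :
    entrySelector (C k) * M * (entrySelector (C l))ᵀ = 0 := by
  obtain ⟨hsymm, hpos⟩ := hM
  set B := entrySelector (C k) * M * (entrySelector (C l))ᵀ with hB
  set W := (entrySelector (C k))ᵀ * B * entrySelector (C l) with hW
  have hWj : ∀ j, entrySelector (C j) * W * (entrySelector (C j))ᵀ = 0 := by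
    intro j
    have hassoc : entrySelector (C j) * W * (entrySelector (C j))ᵀ =
        (entrySelector (C j) * (entrySelector (C k))ᵀ) * B *
          (entrySelector (C l) * (entrySelector (C j))ᵀ) := by
      simp only [hW, Matrix.mul_assoc]
    rw [hassoc]
    by_cases hjk : j = k
    · rw [entrySelector_mul_transpose_of_disjoint (hdisj l j (hjk ▸ hkl.symm)), Matrix.mul_zero]
    · rw [entrySelector_mul_transpose_of_disjoint (hdisj j k hjk), Matrix.zero_mul,
        Matrix.zero_mul]
  have hWj' : ∀ j, entrySelector (C j) * Wᵀ * (entrySelector (C j))ᵀ = 0 := by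
    intro j
    simpa [Matrix.mul_assoc] using congrArg Matrix.transpose (hWj j)
  have hX := hpos (-(W + Wᵀ)) ⟨by
      simp [Matrix.IsSymm, add_comm], fun j => by
      simpa [Matrix.mul_add, Matrix.add_mul, hWj j, hWj' j] using hK0 j⟩
  have htr : (Mᵀ * W).trace = (Bᵀ * B).trace :=
    (trace_transpose_compress_mul (entrySelector (C k)) (entrySelector (C l)) M B).symm
  have htr' : (Mᵀ * Wᵀ).trace = (Mᵀ * W).trace := by
    rw [← Matrix.transpose_mul, Matrix.trace_transpose, Matrix.trace_mul_comm, hsymm.eq]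
  have hnonneg : 0 ≤ (Bᵀ * B).trace := by
    simpa using (Matrix.posSemidef_conjTranspose_mul_self B).trace_nonneg
  rw [Matrix.mul_neg, Matrix.trace_neg, Matrix.mul_add, Matrix.trace_add, htr', htr] at hX
  have hzero : (Bᴴ * B).trace = 0 := by
    rw [Matrix.conjTranspose_eq_transpose_of_trivial]
    linarith
  exact Matrix.trace_conjTranspose_mul_self_eq_zero_iff.mp hzero

/-- Dual equality for pairwise disjoint cliques covering `{1,…,n}`:
`[K(E,?)]* = K*(E,0)`. -/
theorem dual_completion_eq_of_disjoint {n p : ℕ} (C : Fin p → Finset (Fin n))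
    (hdisj : ∀ k k', k ≠ k' → Disjoint (C k) (C k'))
    (hcover : ∀ i : Fin n, ∃ k, i ∈ C k)
    (K : (k : Fin p) → Set (Matrix (Fin (C k).card) (Fin (C k).card) ℝ))
    (hKne : ∀ k, (K k).Nonempty)
    (hKsymm : ∀ k, ∀ Z ∈ K k, Matrix.IsSymm Z)
    (hK0 : ∀ k, (0 : Matrix (Fin (C k).card) (Fin (C k).card) ℝ) ∈ K k) :
    dualCone {X : Matrix (Fin n) (Fin n) ℝ | X.IsSymm ∧
        ∀ k, entrySelector (C k) * X * (entrySelector (C k))ᵀ ∈ K k}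
      = {M : Matrix (Fin n) (Fin n) ℝ |
          ∃ Mk : (k : Fin p) → Matrix (Fin (C k).card) (Fin (C k).card) ℝ,
            (∀ k, Mk k ∈ dualCone (K k)) ∧
            M = ∑ k, (entrySelector (C k))ᵀ * Mk k * entrySelector (C k)} := by
  ext M
  constructor
  · intro hM
    have hoff : ∀ k l, k ≠ l → entrySelector (C k) * M * (entrySelector (C l))ᵀ = 0 :=
      fun k l hkl => offDiagonal_block_eq_zero C hdisj K hK0 hM hkl
    obtain ⟨hsymm, hpos⟩ := hM
    refine ⟨fun k => entrySelector (C k) * M * (entrySelector (C k))ᵀ, fun k => ⟨?_, ?_⟩, ?_⟩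
    · simp [Matrix.IsSymm, hsymm.eq, Matrix.mul_assoc]
    · intro Z hZ
      rw [trace_transpose_compress_mul]
      refine hpos _ ⟨?_, fun j => ?_⟩
      · simp [Matrix.IsSymm, (hKsymm k Z hZ).eq, Matrix.mul_assoc]
      · have hassoc : entrySelector (C j) *
            ((entrySelector (C k))ᵀ * Z * entrySelector (C k)) * (entrySelector (C j))ᵀ =
            (entrySelector (C j) * (entrySelector (C k))ᵀ) * Z *
              (entrySelector (C k) * (entrySelector (C j))ᵀ) := by
          simp only [Matrix.mul_assoc]
        rw [hassoc]
        by_cases hjk : j = k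
        · subst hjk
          simpa [entrySelector_mul_transpose_self] using hZ
        · simpa [entrySelector_mul_transpose_of_disjoint (hdisj j k hjk)] using hK0 j
    · have hone := sum_entrySelector_transpose_mul_self C hdisj hcover
      calc M = (∑ k, (entrySelector (C k))ᵀ * entrySelector (C k)) * M *
              ∑ l, (entrySelector (C l))ᵀ * entrySelector (C l) := by
            rw [hone, Matrix.one_mul, Matrix.mul_one]
        _ = ∑ k, ∑ l, (entrySelector (C k))ᵀ *
              (entrySelector (C k) * M * (entrySelector (C l))ᵀ) * entrySelector (C l) := by
            simp only [Finset.sum_mul, Finset.mul_sum, Matrix.mul_assoc]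
            rw [Finset.sum_comm]
        _ = _ := by
            refine Finset.sum_congr rfl fun k _ => Finset.sum_eq_single k ?_ (by simp)
            intro l _ hl
            rw [hoff k l hl.symm, Matrix.mul_zero, Matrix.zero_mul]
  · rintro ⟨Mk, hMk, rfl⟩
    refine ⟨?_, fun X hX => ?_⟩
    · simp [Matrix.IsSymm, Matrix.transpose_sum, fun k => (hMk k).1.eq, Matrix.mul_assoc]
    · rw [Matrix.transpose_sum, Finset.sum_mul, Matrix.trace_sum]
      refine Finset.sum_nonneg fun k _ => ?_
      have htr := trace_transpose_compress_mul (entrySelector (C k))ᵀ (entrySelector (C k))ᵀ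
        (Mk k) X
      rw [Matrix.transpose_transpose] at htr
      rw [htr]
      exact (hMk k).2 _ (hX.2 k)
end
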